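/- Integral representations of call and put payoffs: let K > 0 and s > 0. (1) For every R with 0 < R < 1, (s − K)₊ − s = (1/(2πi)) ∫_{R−i∞}^{R+i∞} s^z K^{1−z} / (z(z−1)) dz, i.e. (s − K)₊ − s = (1/(2π)) ∫_{−∞}^{∞} s^{R+iu} K^{1−R−iu} / ((R+iu)(R+iu−1)) du. (2) For every R < 0, (K − s)₊ = (1/(2πi)) ∫_{R−i∞}^{R+i∞} s^z K^{1−z} / (z(z−1)) dz. -/

import Mathlib

open MeasureTheory Complex

lemma aux_norm (R c : ℝ) (hc0 : 0 < c) (hc1 : c ≤ 1) (hcR : c ≤ |R|) (y : ℝ) :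
    c * Real.sqrt (1 + y ^ 2) ≤ ‖(R : ℂ) + y * I‖ := by
  rw [Complex.norm_add_mul_I, ← Real.sqrt_sq hc0.le, ← Real.sqrt_mul (sq_nonneg c)]
  apply Real.sqrt_le_sqrt
  have h1 : c ^ 2 ≤ R ^ 2 := by rw [← sq_abs R]; gcongr
  have h2 : c ^ 2 ≤ 1 := by nlinarith
  nlinarith [sq_nonneg y]

lemma aux_ne (R : ℝ) (hR : R ≠ 0) (y : ℝ) : (R : ℂ) + y * I ≠ 0 := by
  intro h
  have := congrArg Complex.re h
  simp at this
  exact hR this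

lemma aux_int (R : ℝ) (h0 : R ≠ 0) (h1 : R - 1 ≠ 0) :
    Integrable (fun y : ℝ => 1 / (((R : ℂ) + y * I) * (((R : ℂ) + y * I) - 1))) := by
  have h0' := abs_pos.2 h0
  have h1' := abs_pos.2 h1
  obtain ⟨c, hc0, hc1, hcR, hcR'⟩ : ∃ c : ℝ, 0 < c ∧ c ≤ 1 ∧ c ≤ |R| ∧ c ≤ |R - 1| :=
    ⟨min 1 (min |R| |R - 1|), by positivity, min_le_left _ _,
      (min_le_right _ _).trans (min_le_left _ _), (min_le_right _ _).trans (min_le_right _ _)⟩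
  have e : ∀ y : ℝ, ((R : ℂ) + y * I) - 1 = ((R - 1 : ℝ) : ℂ) + y * I := by
    intro y; push_cast; ring
  refine Integrable.mono' (integrable_inv_one_add_sq.const_mul ((c ^ 2)⁻¹)) ?_ ?_
  · apply Continuous.aestronglyMeasurable
    refine Continuous.div (by fun_prop) (by fun_prop) fun y => ?_
    rw [e]
    exact mul_ne_zero (aux_ne _ h0 y) (aux_ne _ h1 y)
  · refine Filter.Eventually.of_forall fun y => ?_
    rw [e, norm_div, norm_mul, norm_one, one_div, ← mul_inv]
    have hp : 0 < 1 + y ^ 2 := by positivity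
    apply inv_anti₀ (by positivity)
    calc c ^ 2 * (1 + y ^ 2) = (c * Real.sqrt (1 + y ^ 2)) * (c * Real.sqrt (1 + y ^ 2)) := by
          nlinarith [Real.mul_self_sqrt hp.le]
      _ ≤ _ := by
          gcongr
          · exact aux_norm R c hc0 hc1 hcR y
          · exact aux_norm (R - 1) c hc0 hc1 hcR' y

lemma aux_main (K s R : ℝ) (hK : 0 < K) (hs : 0 < s) (h0 : R ≠ 0) (h1 : R - 1 ≠ 0)
    (f : ℝ → ℂ) (hf : ∀ z : ℂ, z.re = R → HasMellin f z (1 / (z * (z - 1))))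
    (hc : ContinuousAt f (K / s)) :
    K * f (K / s) = (1 / (2 * Real.pi)) *
          ∫ u : ℝ,
            (s : ℂ) ^ ((R : ℂ) + u * Complex.I)
              * (K : ℂ) ^ (1 - ((R : ℂ) + u * Complex.I))
              / (((R : ℂ) + u * Complex.I) * (((R : ℂ) + u * Complex.I) - 1)) := by
  have hm : ∀ y : ℝ, mellin f ((R : ℂ) + y * I)
      = 1 / (((R : ℂ) + y * I) * (((R : ℂ) + y * I) - 1)) := fun y => (hf _ (by simp)).2
  have hsC : (s : ℂ) ≠ 0 := by exact_mod_cast hs.ne'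
  have hKC : (K : ℂ) ≠ 0 := by exact_mod_cast hK.ne'
  have key := mellinInv_mellin_eq R f (div_pos hK hs) (hf R (by simp)).1
    (by
      unfold VerticalIntegrable
      simp_rw [hm]
      exact aux_int R h0 h1) hc
  rw [← key, mellinInv]
  simp_rw [hm]
  rw [Complex.real_smul, ← mul_assoc, mul_comm (K : ℂ), mul_assoc, ← integral_const_mul]
  push_cast
  congr 2
  ext y
  generalize (R : ℂ) + y * I = z
  have : ((K : ℂ) / s) ^ (-z) = K ^ (-z) * s ^ z := by
    rw [div_eq_mul_inv, ← ofReal_inv, mul_cpow_ofReal_nonneg hK.le (by positivity), ofReal_inv,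
      inv_cpow _ _ (by rw [arg_ofReal_of_nonneg hs.le]; exact Real.pi_pos.ne), cpow_neg _ z, cpow_neg _ z, inv_inv]
  rw [this, sub_eq_add_neg 1 z, cpow_add _ _ hKC, cpow_one, smul_eq_mul]
  ring

open Set in
lemma aux_inv (f : ℝ → ℂ) (z m : ℂ) (h : HasMellin f (-z) m) : HasMellin (fun t => f t⁻¹) z m := by
  refine ⟨?_, by rw [mellin_comp_inv]; exact h.2⟩
  have := (MellinConvergent.comp_rpow (f := f) (s := z) (a := -1) (by norm_num)).2
    (by simpa [div_neg] using h.1)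
  simpa [Real.rpow_neg_one] using this

open Set in
lemma aux_two (R : ℝ) (hR : R < 0) (z : ℂ) (hz : z.re = R) :
    HasMellin (fun t : ℝ => ((max (1 - t⁻¹) 0 : ℝ) : ℂ)) z (1 / (z * (z - 1))) := by
  have a1 := hasMellin_one_Ioc (s := -z) (by simp; linarith)
  have a2 := hasMellin_cpow_Ioc 1 (s := -z) (by simp; linarith)
  have a3 := aux_inv _ _ _ (hasMellin_sub a1.1 a2.1)
  rw [a1.2, a2.2] at a3
  have z0 : z ≠ 0 := by rintro rfl; simp at hz; linarith
  have z1 : z - 1 ≠ 0 := by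
    intro h; have := congrArg re h; simp at this; linarith
  have z2 : -z + 1 ≠ 0 := by
    intro h; apply z1; linear_combination -h
  have e : 1 / -z - 1 / (-z + 1) = 1 / (z * (z - 1)) := by
    have : -z + 1 = -(z - 1) := by ring
    rw [this]; field_simp; ring
  rw [e] at a3
  have E : EqOn (fun t : ℝ => (t : ℂ) ^ (z - 1) • ((max (1 - t⁻¹) 0 : ℝ) : ℂ))
     (fun t : ℝ => (t : ℂ) ^ (z - 1) • ((Ioc 0 1).indicator (fun _ => 1 : ℝ → ℂ) t⁻¹ -
        (Ioc 0 1).indicator (fun t => ↑t ^ (1 : ℂ) : ℝ → ℂ) t⁻¹)) (Ioi 0) := by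
    intro t ht
    have ht' : 0 < t⁻¹ := inv_pos.2 ht
    simp only
    congr 1
    by_cases h : t⁻¹ ≤ 1
    · have hm : t⁻¹ ∈ Ioc (0 : ℝ) 1 := ⟨ht', h⟩
      rw [indicator_of_mem hm, indicator_of_mem hm, max_eq_left (by linarith)]
      simp
    · have : t⁻¹ ∉ Ioc (0 : ℝ) 1 := fun q => h q.2
      rw [indicator_of_notMem this, indicator_of_notMem this, max_eq_right (by linarith)]
      simp
  refine ⟨(integrableOn_congr_fun E measurableSet_Ioi).2 a3.1, ?_⟩
  rw [← a3.2]
  exact setIntegral_congr_fun measurableSet_Ioi E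

open Set in
lemma aux_one (R : ℝ) (hR : 0 < R) (hR1 : R < 1) (z : ℂ) (hz : z.re = R) :
    HasMellin (fun t : ℝ => ((-min t⁻¹ 1 : ℝ) : ℂ)) z (1 / (z * (z - 1))) := by
  have a1 := hasMellin_one_Ioc (s := z) (by linarith)
  have a2 := aux_inv _ _ _ (hasMellin_cpow_Ioc 1 (s := -z) (by simp; linarith))
  have a3 := hasMellin_const_smul (hasMellin_add a1.1 a2.1).1 (-1 : ℂ)
  rw [(hasMellin_add a1.1 a2.1).2, a1.2, a2.2] at a3
  have z0 : z ≠ 0 := by rintro rfl; simp at hz; linarith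
  have z1 : z - 1 ≠ 0 := by
    intro h; have := congrArg re h; simp at this; linarith
  have e : (-1 : ℂ) • (1 / z + 1 / (-z + 1)) = 1 / (z * (z - 1)) := by
    have : -z + 1 = -(z - 1) := by ring
    rw [this, smul_eq_mul]; field_simp; ring
  rw [e] at a3
  have E : (fun t : ℝ => (t : ℂ) ^ (z - 1) • ((-min t⁻¹ 1 : ℝ) : ℂ)) =ᵐ[volume.restrict (Ioi 0)]
     (fun t : ℝ => (t : ℂ) ^ (z - 1) • ((-1 : ℂ) • ((Ioc 0 1).indicator (fun _ => 1 : ℝ → ℂ) t +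
        (Ioc 0 1).indicator (fun t => ↑t ^ (1 : ℂ) : ℝ → ℂ) t⁻¹))) := by
    filter_upwards [ae_restrict_mem measurableSet_Ioi,
      ae_restrict_of_ae (Measure.ae_ne volume (1 : ℝ))] with t ht ht1
    have ht0 : 0 < t := ht
    have ht' : 0 < t⁻¹ := inv_pos.2 ht
    congr 1
    rcases lt_or_gt_of_ne ht1 with h | h
    · have h2 : 1 < t⁻¹ := (one_lt_inv₀ ht0).2 h
      have : t⁻¹ ∉ Ioc (0 : ℝ) 1 := fun q => absurd q.2 (not_le.2 h2)
      rw [indicator_of_mem (show t ∈ Ioc (0 : ℝ) 1 from ⟨ht0, h.le⟩), indicator_of_notMem this, min_eq_right h2.le]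
      simp
    · have h2 : t⁻¹ < 1 := inv_lt_one_of_one_lt₀ h
      have : t ∉ Ioc (0 : ℝ) 1 := fun q => absurd q.2 (not_le.2 h)
      rw [indicator_of_notMem this, indicator_of_mem (show t⁻¹ ∈ Ioc (0 : ℝ) 1 from ⟨ht', h2.le⟩), min_eq_left h2.le]
      simp
  refine ⟨(integrable_congr E).2 a3.1, ?_⟩
  rw [← a3.2]
  exact integral_congr_ae E

/-- Integral representations of call and put payoffs.  For `K, s > 0`:
(1) for every `0 < R < 1`,
`(s − K)₊ − s = (1/(2πi)) ∫_{R−i∞}^{R+i∞} s^z K^{1−z}/(z(z−1)) dz`, i.e.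
`(s − K)₊ − s = (1/(2π)) ∫_ℝ s^{R+iu} K^{1−R−iu}/((R+iu)(R+iu−1)) du`;
(2) for every `R < 0`,
`(K − s)₊ = (1/(2π)) ∫_ℝ s^{R+iu} K^{1−R−iu}/((R+iu)(R+iu−1)) du`. -/
theorem stmt_8 (K s : ℝ) (hK : 0 < K) (hs : 0 < s) :
    (∀ R : ℝ, 0 < R → R < 1 →
      ((max (s - K) 0 - s : ℝ) : ℂ)
        = (1 / (2 * Real.pi)) *
          ∫ u : ℝ,
            (s : ℂ) ^ ((R : ℂ) + u * Complex.I)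
              * (K : ℂ) ^ (1 - ((R : ℂ) + u * Complex.I))
              / (((R : ℂ) + u * Complex.I) * (((R : ℂ) + u * Complex.I) - 1)))
    ∧ (∀ R : ℝ, R < 0 →
      ((max (K - s) 0 : ℝ) : ℂ)
        = (1 / (2 * Real.pi)) *
          ∫ u : ℝ,
            (s : ℂ) ^ ((R : ℂ) + u * Complex.I)
              * (K : ℂ) ^ (1 - ((R : ℂ) + u * Complex.I))
              / (((R : ℂ) + u * Complex.I) * (((R : ℂ) + u * Complex.I) - 1))) := by
  have hx : K / s ≠ 0 := (div_pos hK hs).ne'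
  constructor
  · intro R h0 h1
    rw [← aux_main K s R hK hs h0.ne' (by linarith) _ (aux_one R h0 h1)
      (by
        apply Complex.continuous_ofReal.continuousAt.comp
        exact ((continuousAt_inv₀ hx).min continuousAt_const).neg)]
    rw [← ofReal_mul]
    congr 1
    rw [inv_div, mul_neg, mul_min_of_nonneg _ _ hK.le, mul_div_cancel₀ _ hK.ne', mul_one]
    rcases le_total s K with h | h
    · rw [max_eq_right (by linarith), min_eq_left h]; ring
    · rw [max_eq_left (by linarith), min_eq_right h]; ring
  · intro R h0
    rw [← aux_main K s R hK hs h0.ne (by linarith) _ (aux_two R h0)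
      (by
        apply Complex.continuous_ofReal.continuousAt.comp
        exact (continuousAt_const.sub (continuousAt_inv₀ hx)).max continuousAt_const)]
    rw [← ofReal_mul]
    congr 1
    rw [inv_div, mul_max_of_nonneg _ _ hK.le, mul_sub, mul_div_cancel₀ _ hK.ne', mul_one, mul_zero]
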